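/- There exist a metric space X, a skew-evolution semiflow C = (φ,Φ) on X × ℝ² (with ℝ² normed by ‖(v₁,v₂)‖ = |v₁| + |v₂|), and projectors P₁, P₂ compatible with C, such that C is Barreira–Valls polynomially dichotomic with respect to P₁, P₂, but for every choice of constants N ≥ 1 and α₁, α₂ > 0 the uniform polynomial dichotomy estimates with respect to P₁, P₂ fail; that is, C is not uniformly polynomially dichotomic with respect to P₁, P₂. -/

import Mathlib

open Real MeasureTheory

section SkewEvolution

variable {X : Type*} [MetricSpace X] {V : Type*} [NormedAddCommGroup V] [NormedSpace ℝ V]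

/-- `φ : T × X → X` is an evolution semiflow (`φ t s x` for `t ≥ s ≥ 0`). -/
def IsEvolutionSemiflow (φ : ℝ → ℝ → X → X) : Prop :=
  (∀ t x, 0 ≤ t → φ t t x = x) ∧
  ∀ t s t₀ x, 0 ≤ t₀ → t₀ ≤ s → s ≤ t → φ t s (φ s t₀ x) = φ t t₀ x

/-- `Φ : T × X → B(V)` is an evolution cocycle over the evolution semiflow `φ`. -/
def IsEvolutionCocycle (φ : ℝ → ℝ → X → X) (Φ : ℝ → ℝ → X → (V →L[ℝ] V)) : Prop :=
  (∀ t x, 0 ≤ t → Φ t t x = ContinuousLinearMap.id ℝ V) ∧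
  ∀ t s t₀ x, 0 ≤ t₀ → t₀ ≤ s → s ≤ t →
    (Φ t s (φ s t₀ x)).comp (Φ s t₀ x) = Φ t t₀ x

/-- `C = (φ, Φ)` is a skew-evolution semiflow on `X × V`. -/
def IsSkewEvolutionSemiflow (φ : ℝ → ℝ → X → X) (Φ : ℝ → ℝ → X → (V →L[ℝ] V)) : Prop :=
  IsEvolutionSemiflow φ ∧ IsEvolutionCocycle φ Φ

/-- A projector on `X × V`: each `P x` is a bounded linear projection and
`(x, v) ↦ P x v` is continuous. -/
def IsProjector (P : X → (V →L[ℝ] V)) : Prop :=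
  (∀ x, (P x).comp (P x) = P x) ∧ Continuous fun p : X × V => P p.1 p.2

/-- A projector invariant relative to the skew-evolution semiflow `C = (φ, Φ)`. -/
def IsInvariantProjector (φ : ℝ → ℝ → X → X) (Φ : ℝ → ℝ → X → (V →L[ℝ] V))
    (P : X → (V →L[ℝ] V)) : Prop :=
  IsProjector P ∧
  ∀ t s x, 0 ≤ s → s ≤ t → (P (φ t s x)).comp (Φ t s x) = (Φ t s x).comp (P x)

/-- Projectors `P₁, P₂` compatible with `C = (φ, Φ)`: `P₂ x = I - P₁ x` and both
are invariant relative to `C`. -/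
def CompatibleProjectors (φ : ℝ → ℝ → X → X) (Φ : ℝ → ℝ → X → (V →L[ℝ] V))
    (P₁ P₂ : X → (V →L[ℝ] V)) : Prop :=
  (∀ x, P₂ x = ContinuousLinearMap.id ℝ V - P₁ x) ∧
  IsInvariantProjector φ Φ P₁ ∧ IsInvariantProjector φ Φ P₂

/-- `C` has exponential growth. -/
def HasExpGrowth (Φ : ℝ → ℝ → X → (V →L[ℝ] V)) : Prop :=
  ∃ M ω : ℝ → ℝ, (∀ s, 0 ≤ s → 0 < M s) ∧ (∀ s, 0 ≤ s → 0 < ω s) ∧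
    ∀ t s t₀ (x : X) (v : V), 0 ≤ t₀ → t₀ ≤ s → s ≤ t →
      ‖Φ t t₀ x v‖ ≤ M s * Real.exp (ω s * (t - s)) * ‖Φ s t₀ x v‖

/-- `C` has exponential decay. -/
def HasExpDecay (Φ : ℝ → ℝ → X → (V →L[ℝ] V)) : Prop :=
  ∃ M ω : ℝ → ℝ, (∀ t, 0 ≤ t → 0 < M t) ∧ (∀ t, 0 ≤ t → 0 < ω t) ∧
    ∀ t s t₀ (x : X) (v : V), 0 ≤ t₀ → t₀ ≤ s → s ≤ t →
      ‖Φ s t₀ x v‖ ≤ M t * Real.exp (ω t * (t - s)) * ‖Φ t t₀ x v‖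

/-- `C` has bounded exponential growth. -/
def HasBoundedExpGrowth (Φ : ℝ → ℝ → X → (V →L[ℝ] V)) : Prop :=
  ∃ M ω : ℝ, 1 ≤ M ∧ 0 < ω ∧
    ∀ t s (x : X), 0 ≤ s → s ≤ t → ‖Φ t s x‖ ≤ M * Real.exp (ω * (t - s))

/-- `C` has uniform exponential decay. -/
def HasUnifExpDecay (Φ : ℝ → ℝ → X → (V →L[ℝ] V)) : Prop :=
  ∃ M ω : ℝ, 1 ≤ M ∧ 0 < ω ∧
    ∀ t s t₀ (x : X) (v : V), 0 ≤ t₀ → t₀ ≤ s → s ≤ t →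
      ‖Φ s t₀ x v‖ ≤ M * Real.exp (ω * (t - s)) * ‖Φ t t₀ x v‖

/-- `C` is strongly measurable: `s ↦ ‖Φ(s, t₀, x) v‖` is measurable on `[t₀, ∞)`. -/
def IsStronglyMeasurableSES (Φ : ℝ → ℝ → X → (V →L[ℝ] V)) : Prop :=
  ∀ t₀ (x : X) (v : V), 0 ≤ t₀ →
    Measurable fun s : Set.Ici t₀ => ‖Φ (s : ℝ) t₀ x v‖

/-- Uniform exponential dichotomy with respect to compatible projectors `P₁, P₂`. -/
def IsUnifExpDichotomic (Φ : ℝ → ℝ → X → (V →L[ℝ] V))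
    (P₁ P₂ : X → (V →L[ℝ] V)) : Prop :=
  ∃ N₁ N₂ ν₁ ν₂ : ℝ, 1 ≤ N₁ ∧ 1 ≤ N₂ ∧ 0 < ν₁ ∧ 0 < ν₂ ∧
    ∀ t s t₀ (x : X) (v : V), 0 ≤ t₀ → t₀ ≤ s → s ≤ t →
      Real.exp (ν₁ * (t - s)) * ‖Φ t t₀ x (P₁ x v)‖ ≤ N₁ * ‖Φ s t₀ x (P₁ x v)‖ ∧
      Real.exp (ν₂ * (t - s)) * ‖Φ s t₀ x (P₂ x v)‖ ≤ N₂ * ‖Φ t t₀ x (P₂ x v)‖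

/-- Barreira-Valls exponential dichotomy with respect to compatible projectors `P₁, P₂`. -/
def IsBVExpDichotomic (Φ : ℝ → ℝ → X → (V →L[ℝ] V))
    (P₁ P₂ : X → (V →L[ℝ] V)) : Prop :=
  ∃ N α₁ α₂ β₁ β₂ : ℝ, 1 ≤ N ∧ 0 < α₁ ∧ 0 < α₂ ∧ 0 < β₁ ∧ 0 < β₂ ∧
    ∀ t s t₀ (x : X) (v : V), 0 ≤ t₀ → t₀ ≤ s → s ≤ t →
      ‖Φ t t₀ x (P₁ x v)‖ ≤ N * Real.exp (-α₁ * t) * Real.exp (β₁ * s) * ‖Φ s t₀ x (P₁ x v)‖ ∧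
      ‖Φ s t₀ x (P₂ x v)‖ ≤ N * Real.exp (-α₂ * t) * Real.exp (β₂ * s) * ‖Φ t t₀ x (P₂ x v)‖

/-- (Nonuniform) exponential dichotomy with respect to compatible projectors `P₁, P₂`. -/
def IsExpDichotomic (Φ : ℝ → ℝ → X → (V →L[ℝ] V))
    (P₁ P₂ : X → (V →L[ℝ] V)) : Prop :=
  ∃ (N₁ N₂ : ℝ → ℝ) (ν₁ ν₂ : ℝ), (∀ s, 0 ≤ s → 0 < N₁ s) ∧ (∀ s, 0 ≤ s → 0 < N₂ s) ∧
    0 < ν₁ ∧ 0 < ν₂ ∧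
    ∀ t s t₀ (x : X) (v : V), 0 ≤ t₀ → t₀ ≤ s → s ≤ t →
      ‖Φ t t₀ x (P₁ x v)‖ ≤ N₁ s * Real.exp (-ν₁ * t) * ‖Φ s t₀ x (P₁ x v)‖ ∧
      ‖Φ s t₀ x (P₂ x v)‖ ≤ N₂ s * Real.exp (-ν₂ * t) * ‖Φ t t₀ x (P₂ x v)‖

/-- Uniform polynomial dichotomy with respect to compatible projectors `P₁, P₂`. -/
def IsUnifPolyDichotomic (Φ : ℝ → ℝ → X → (V →L[ℝ] V))
    (P₁ P₂ : X → (V →L[ℝ] V)) : Prop :=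
  ∃ N α₁ α₂ : ℝ, 1 ≤ N ∧ 0 < α₁ ∧ 0 < α₂ ∧
    ∀ t s (x : X) (v : V), 1 ≤ s → s ≤ t →
      ‖Φ t s x (P₁ x v)‖ ≤ N * t ^ (-α₁) * s ^ α₁ * ‖P₁ x v‖ ∧
      ‖P₂ x v‖ ≤ N * t ^ (-α₂) * s ^ α₂ * ‖Φ t s x (P₂ x v)‖

/-- Barreira-Valls polynomial dichotomy with respect to compatible projectors `P₁, P₂`. -/
def IsBVPolyDichotomic (Φ : ℝ → ℝ → X → (V →L[ℝ] V))
    (P₁ P₂ : X → (V →L[ℝ] V)) : Prop :=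
  ∃ N α₁ α₂ β₁ β₂ : ℝ, 1 ≤ N ∧ 0 < α₁ ∧ 0 < α₂ ∧ 0 < β₁ ∧ 0 < β₂ ∧
    ∀ t s (x : X) (v : V), 1 ≤ s → s ≤ t →
      ‖Φ t s x (P₁ x v)‖ ≤ N * t ^ (-α₁) * s ^ β₁ * ‖P₁ x v‖ ∧
      ‖P₂ x v‖ ≤ N * t ^ (-α₂) * s ^ β₂ * ‖Φ t s x (P₂ x v)‖

/-- (Nonuniform) polynomial dichotomy with respect to compatible projectors `P₁, P₂`. -/
def IsPolyDichotomic (Φ : ℝ → ℝ → X → (V →L[ℝ] V))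
    (P₁ P₂ : X → (V →L[ℝ] V)) : Prop :=
  ∃ (N : ℝ → ℝ) (α₁ α₂ : ℝ), (∀ s, 0 ≤ s → 1 ≤ N s) ∧ 0 < α₁ ∧ 0 < α₂ ∧
    ∀ t s (x : X) (v : V), 1 ≤ s → s ≤ t →
      ‖Φ t s x (P₁ x v)‖ ≤ N s * t ^ (-α₁) * ‖P₁ x v‖ ∧
      ‖P₂ x v‖ ≤ N s * t ^ (-α₂) * ‖Φ t s x (P₂ x v)‖

end SkewEvolution

/-- Diagonal operator on `ℝ²` with the `ℓ¹` norm. -/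
noncomputable def diagOp (a b : ℝ) : WithLp 1 (ℝ × ℝ) →L[ℝ] WithLp 1 (ℝ × ℝ) :=
  ((WithLp.prodContinuousLinearEquiv 1 ℝ ℝ ℝ).symm : (ℝ × ℝ) →L[ℝ] WithLp 1 (ℝ × ℝ)).comp
    (((a • ContinuousLinearMap.id ℝ ℝ).prodMap (b • ContinuousLinearMap.id ℝ ℝ)).comp
      ((WithLp.prodContinuousLinearEquiv 1 ℝ ℝ ℝ) : WithLp 1 (ℝ × ℝ) →L[ℝ] (ℝ × ℝ)))

lemma diagOp_apply (a b : ℝ) (v : WithLp 1 (ℝ × ℝ)) :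
    diagOp a b v = WithLp.toLp 1 (a * v.fst, b * v.snd) := rfl

lemma diagOp_norm (a b : ℝ) (v : WithLp 1 (ℝ × ℝ)) :
    ‖diagOp a b v‖ = |a| * |v.fst| + |b| * |v.snd| := by
  rw [WithLp.prod_norm_eq_of_L1, diagOp_apply]
  simp [abs_mul]

lemma diagOp_comp (a b c d : ℝ) : (diagOp a b).comp (diagOp c d) = diagOp (a * c) (b * d) := by
  ext v <;> simp [diagOp_apply, mul_assoc]

lemma diagOp_comp_apply (a b c d : ℝ) (v) : (diagOp a b) (diagOp c d v) =
    diagOp (a * c) (b * d) v := by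
  rw [← diagOp_comp]; rfl

lemma diagOp_one : diagOp 1 1 = ContinuousLinearMap.id ℝ _ := by
  ext v; simp only [diagOp_apply, one_mul]; rfl

lemma diagOp_sub (a b c d : ℝ) : diagOp a b - diagOp c d = diagOp (a - c) (b - d) := by
  ext v
  simp only [ContinuousLinearMap.sub_apply, diagOp_apply, sub_mul]; rfl

/-- The oscillating weight. -/
noncomputable def wt (t : ℝ) : ℝ := (1 + t * cos t ^ 2) / (1 + t) ^ 2

lemma wt_pos {t : ℝ} (ht : 0 ≤ t) : 0 < wt t := by
  unfold wt; positivity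

lemma wt_ratio {t s : ℝ} (hs : 1 ≤ s) (hst : s ≤ t) :
    wt t / wt s ≤ 4 * t ^ (-1 : ℝ) * s ^ (2 : ℝ) := by
  have hs0 : 0 < s := by linarith
  have ht0 : 0 < t := by linarith
  rw [div_le_iff₀ (wt_pos hs0.le), Real.rpow_neg_one, Real.rpow_two]
  have h1 : wt t ≤ 1 / t := by
    unfold wt
    rw [div_le_div_iff₀ (by positivity) ht0]
    nlinarith [Real.cos_sq_le_one t, mul_le_mul_of_nonneg_left (Real.cos_sq_le_one t) (sq_nonneg t)]
  have h2 : 1 / (4 * s ^ 2) ≤ wt s := by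
    unfold wt
    rw [div_le_div_iff₀ (by positivity) (by positivity)]
    have : 0 ≤ s * cos s ^ 2 * (4 * s ^ 2) := by positivity
    nlinarith
  calc wt t ≤ 1 / t := h1
    _ = 4 * t⁻¹ * s ^ 2 * (1 / (4 * s ^ 2)) := by field_simp
    _ ≤ _ := by gcongr

lemma wt_unbdd (N : ℝ) : ∃ t s : ℝ, 1 ≤ s ∧ s ≤ t ∧ N < wt t / wt s := by
  obtain ⟨n, hn⟩ := exists_nat_gt (2 * |N|)
  have hpi := Real.pi_gt_three
  have hpi4 := Real.pi_le_four
  have hn0 : (0 : ℝ) ≤ n := Nat.cast_nonneg n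
  have hnpi : (n : ℝ) ≤ n * π := by nlinarith
  refine ⟨((n + 1 : ℕ) : ℝ) * π, n * π + π / 2, by linarith, by push_cast; linarith, ?_⟩
  have hc : cos (((n + 1 : ℕ) : ℝ) * π) ^ 2 = 1 := by
    rw [Real.cos_sq', Real.sin_nat_mul_pi]; simp
  have hc' : cos (n * π + π / 2) = 0 := by
    rw [Real.cos_add_pi_div_two, Real.sin_nat_mul_pi]; simp
  have hs : (((n + 1 : ℕ) : ℝ) * π) = (n * π + π / 2) + π / 2 := by push_cast; ring
  unfold wt
  rw [hc, hc', hs]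
  have hs0 : (n : ℝ) + 1 ≤ n * π + π / 2 := by linarith
  generalize n * π + π / 2 = s at *
  have : (1 + (s + π / 2) * 1) / (1 + (s + π / 2)) ^ 2 / ((1 + s * 0 ^ 2) / (1 + s) ^ 2)
      = (1 + s) ^ 2 / (1 + (s + π / 2)) := by
    have : 0 < 1 + (s + π / 2) := by linarith
    have : 0 < 1 + s := by linarith
    field_simp
    ring
  rw [this, lt_div_iff₀ (by linarith)]
  have hN := le_abs_self N
  have hN0 := abs_nonneg N
  nlinarith

/-- there is a skew-evolution semiflow on `X × ℝ²` (with the `ℓ¹` norm) that is Barreira-Valls polynomially dichotomic but not uniformly polynomially dichotomic. -/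
theorem exists_bvPolyDichotomic_not_unifPolyDichotomic :
    ∃ (X : Type) (_ : MetricSpace X)
      (φ : ℝ → ℝ → X → X)
      (Φ : ℝ → ℝ → X → (WithLp 1 (ℝ × ℝ) →L[ℝ] WithLp 1 (ℝ × ℝ)))
      (P₁ P₂ : X → (WithLp 1 (ℝ × ℝ) →L[ℝ] WithLp 1 (ℝ × ℝ))),
      IsSkewEvolutionSemiflow φ Φ ∧ CompatibleProjectors φ Φ P₁ P₂ ∧
      IsBVPolyDichotomic Φ P₁ P₂ ∧ ¬ IsUnifPolyDichotomic Φ P₁ P₂ := by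
  refine ⟨Unit, inferInstance, fun _ _ x => x,
    fun t s _ => diagOp (wt t / wt s) (wt s / wt t), fun _ => diagOp 1 0, fun _ => diagOp 0 1,
    ⟨⟨fun _ _ _ => rfl, fun _ _ _ _ _ _ _ => rfl⟩, ?_, ?_⟩, ⟨?_, ⟨⟨?_, ?_⟩, ?_⟩, ⟨?_, ?_⟩, ?_⟩,
    ?_, ?_⟩
  · intro t x ht
    have := (wt_pos ht).ne'
    simp only [div_self this, diagOp_one]
  · intro t s t₀ x h0 h1 h2
    have e1 := (wt_pos h0).ne'
    have e2 := (wt_pos (h0.trans h1)).ne'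
    have e3 := (wt_pos ((h0.trans h1).trans h2)).ne'
    simp only [diagOp_comp]
    congr 1 <;> field_simp
  · intro x
    rw [← diagOp_one, diagOp_sub]; norm_num
  · intro x; simp [diagOp_comp]
  · exact (diagOp 1 0).continuous.comp continuous_snd
  · intro t s x _ _; simp [diagOp_comp]
  · intro x; simp [diagOp_comp]
  · exact (diagOp 0 1).continuous.comp continuous_snd
  · intro t s x _ _; simp [diagOp_comp]
  · refine ⟨4, 1, 1, 2, 2, by norm_num, by norm_num, by norm_num, by norm_num, by norm_num, ?_⟩
    intro t s x v hs hst
    have h := wt_ratio hs hst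
    have ps := wt_pos (zero_le_one.trans hs)
    have pt := wt_pos ((zero_le_one.trans hs).trans hst)
    simp only [diagOp_comp_apply, diagOp_norm, mul_one, mul_zero, abs_zero, zero_mul, add_zero,
      zero_add, abs_one, one_mul]
    rw [abs_of_pos (div_pos pt ps), abs_of_pos (div_pos ps pt)]
    refine ⟨mul_le_mul_of_nonneg_right h (abs_nonneg _), ?_⟩
    rw [← mul_assoc]
    refine le_mul_of_one_le_left (abs_nonneg _) ?_
    calc (1 : ℝ) = wt t / wt s * (wt s / wt t) := by field_simp
      _ ≤ _ := mul_le_mul_of_nonneg_right h (div_pos ps pt).le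
  · rintro ⟨N, α, α₂, hN, hα, -, H⟩
    obtain ⟨t, s, hs, hst, h⟩ := wt_unbdd N
    have h1 := (H t s () (WithLp.toLp 1 (1, 0)) hs hst).1
    have ps := wt_pos (zero_le_one.trans hs)
    have pt := wt_pos ((zero_le_one.trans hs).trans hst)
    simp only [diagOp_comp_apply, diagOp_norm, mul_one, mul_zero, abs_zero, zero_mul, add_zero,
      abs_one] at h1
    rw [abs_of_pos (div_pos pt ps)] at h1
    have h0 : |(WithLp.toLp 1 ((1 : ℝ), (0 : ℝ))).fst| = 1 := abs_one
    rw [h0] at h1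
    have hs0 : 0 < s := by linarith
    have ht0 : 0 < t := by linarith
    have h2 : t ^ (-α) * s ^ α ≤ 1 := by
      rw [Real.rpow_neg ht0.le, inv_mul_le_iff₀ (by positivity), mul_one]
      exact Real.rpow_le_rpow hs0.le hst hα.le
    have h3 : N * (t ^ (-α) * s ^ α) ≤ N * 1 := mul_le_mul_of_nonneg_left h2 (by linarith)
    rw [← mul_assoc] at h3
    linarith
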